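/- (k-fold composition for homogeneous mechanisms.) Let ε > 0, δ ∈ [0,1], δ̃ ∈ (0,1], and k ≥ 1. Let K₁, …, K_k be mechanisms, each (ε, δ)-differentially private for both ordered pairs (D₁, D₂) and (D₂, D₁). Then the product mechanism D ↦ K₁(D) ⊗ ⋯ ⊗ K_k(D) is (ε̃, 1 − (1−δ)^k·(1−δ̃))-differentially private for (D₁, D₂), where ε̃ = min{ kε, ((e^ε−1)kε)/(e^ε+1) + ε·√(2k·ln(e + √(kε²)/δ̃)), ((e^ε−1)kε)/(e^ε+1) + ε·√(2k·ln(1/δ̃)) }. -/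

import Mathlib

open MeasureTheory
open scoped BigOperators ENNReal

section Composition

open ProbabilityTheory Set

lemma ofReal_smul_le_iff_measureReal {α : Type*} [MeasurableSpace α] {μ ν : Measure α}
    [IsFiniteMeasure μ] [IsFiniteMeasure ν] {a : ℝ} (ha : 0 ≤ a) :
    ENNReal.ofReal a • μ ≤ ν ↔ ∀ s, MeasurableSet s → a * μ.real s ≤ ν.real s := by
  rw [Measure.le_iff]
  refine forall₂_congr fun s _ => ?_
  rw [Measure.smul_apply, smul_eq_mul, ← ofReal_measureReal (μ := μ),
    ← ofReal_measureReal (μ := ν), ← ENNReal.ofReal_mul ha,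
    ENNReal.ofReal_le_ofReal_iff measureReal_nonneg]

lemma smul_pi_le_pi {ι : Type*} [Fintype ι] {R : ι → Type*} [∀ j, MeasurableSpace (R j)]
    {P Q : ∀ j, Measure (R j)} [∀ j, SigmaFinite (P j)] {c : ℝ≥0∞}
    (h : ∀ j, c • P j ≤ Q j) : c ^ Fintype.card ι • Measure.pi P ≤ Measure.pi Q := by
  rw [Measure.le_iff]
  intro S hS
  rw [Measure.pi_def Q, toMeasure_apply _ _ hS, ← Measure.coe_toOuterMeasure]
  suffices (c ^ Fintype.card ι • Measure.pi P).toOuterMeasure ≤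
      OuterMeasure.pi fun j => (Q j).toOuterMeasure from this S
  rw [OuterMeasure.le_pi]
  intro s _
  simp only [Measure.coe_toOuterMeasure, Measure.smul_apply, Measure.pi_pi, smul_eq_mul]
  rw [← Finset.card_univ, ← Finset.prod_const, ← Finset.prod_mul_distrib]
  exact Finset.prod_le_prod' fun j _ => h j (s j)

lemma lintegral_pi_prod_eq_prod_lintegral {ι : Type*} [Fintype ι] {R : ι → Type*}
    [∀ j, MeasurableSpace (R j)] (P : ∀ j, Measure (R j)) [∀ j, IsProbabilityMeasure (P j)]
    {f : ∀ j, R j → ℝ≥0∞} (hf : ∀ j, Measurable (f j)) :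
    ∫⁻ x, ∏ j, f j (x j) ∂Measure.pi P = ∏ j, ∫⁻ x, f j x ∂P j := by
  refine (lintegral_prod_eq_prod_lintegral_of_indepFun Finset.univ
    (fun j (x : ∀ j, R j) => f j (x j)) (iIndepFun_pi fun j => (hf j).aemeasurable)
    (fun j => (hf j).comp (measurable_pi_apply j))).trans ?_
  refine Finset.prod_congr rfl fun j _ => ?_
  exact (measurePreserving_eval P j).lintegral_comp (hf j)

lemma pi_withDensity_eq {ι : Type*} [Fintype ι] {R : ι → Type*}
    [∀ j, MeasurableSpace (R j)] (P : ∀ j, Measure (R j)) [∀ j, IsProbabilityMeasure (P j)]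
    {f : ∀ j, R j → ℝ≥0∞} (hf : ∀ j, Measurable (f j))
    [∀ j, SigmaFinite ((P j).withDensity (f j))] :
    Measure.pi (fun j => (P j).withDensity (f j)) =
      (Measure.pi P).withDensity fun x => ∏ j, f j (x j) := by
  refine Measure.pi_eq fun s hs => ?_
  rw [withDensity_apply _ (.univ_pi hs), ← lintegral_indicator (.univ_pi hs)]
  simp_rw [withDensity_apply _ (hs _), ← lintegral_indicator (hs _)]
  rw [← lintegral_pi_prod_eq_prod_lintegral P fun j => (hf j).indicator (hs j)]
  refine lintegral_congr fun x => ?_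
  by_cases hx : x ∈ univ.pi s
  · rw [indicator_of_mem hx]
    exact Finset.prod_congr rfl fun j _ => (indicator_of_mem (hx j (mem_univ j)) _).symm
  · rw [indicator_of_notMem hx]
    obtain ⟨j, hj⟩ : ∃ j, x j ∉ s j := by simpa [mem_univ_pi] using hx
    exact (Finset.prod_eq_zero (Finset.mem_univ j) (indicator_of_notMem hj _)).symm

/-- The `e^ε`-truncation `P ⊓ e^ε Q` of an `(ε, δ)`-close pair has mass at least `1 - δ`. -/
lemma one_sub_le_inf_smul_univ {α : Type*} [MeasurableSpace α] {P Q : Measure α}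
    [IsProbabilityMeasure P] {c : ℝ≥0∞} {δ : ℝ≥0∞}
    (h : ∀ S, MeasurableSet S → P S ≤ c * Q S + δ) :
    1 - δ ≤ (P ⊓ c • Q) univ := by
  rw [Measure.inf_apply .univ]
  refine le_sInf ?_
  rintro _ ⟨t, rfl⟩
  simp only [inter_univ, Measure.smul_apply, smul_eq_mul]
  rw [tsub_le_iff_right, ← measure_toMeasurable t]
  have hT := measurableSet_toMeasurable P t
  calc (1 : ℝ≥0∞) = P (toMeasurable P t) + P (toMeasurable P t)ᶜ := by
        rw [measure_add_measure_compl hT, measure_univ]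
    _ ≤ P (toMeasurable P t) + (c * Q (toMeasurable P t)ᶜ + δ) := by gcongr; exact h _ hT.compl
    _ ≤ P (toMeasurable P t) + c * Q tᶜ + δ := by
        rw [add_assoc]; gcongr; exact subset_toMeasurable P t

/-- Two mutually `r`-dominated measures of mass at least `w` dominate `w` times a pair of mutually
`r`-dominated probability measures. -/
lemma exists_probability_smul_le_of_le {α : Type*} [MeasurableSpace α] {p q : Measure α}
    [IsFiniteMeasure p] [IsFiniteMeasure q] {r w : ℝ} (hr : 0 < r) (hr1 : r < 1) (hw : 0 < w)
    (hpq : ENNReal.ofReal r • p ≤ q) (hqp : ENNReal.ofReal r • q ≤ p)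
    (hwq : w ≤ q.real univ) (hle : q.real univ ≤ p.real univ) :
    ∃ p' q' : Measure α, IsProbabilityMeasure p' ∧ IsProbabilityMeasure q' ∧
      ENNReal.ofReal w • p' ≤ p ∧ ENNReal.ofReal w • q' ≤ q ∧
      ENNReal.ofReal r • p' ≤ q' ∧ ENNReal.ofReal r • q' ≤ p' := by
  rw [ofReal_smul_le_iff_measureReal hr.le] at hpq hqp
  set a := p.real univ with ha
  set b := q.real univ with hb
  have hb0 : 0 < b := hw.trans_le hwq
  have hden : 0 < a - r * b := by nlinarith
  obtain ⟨t, ht0, ht1, ht⟩ : ∃ t : ℝ, 0 ≤ t ∧ t ≤ 1 ∧ t * a + (1 - t) * r * b = b := by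
    refine ⟨(b - r * b) / (a - r * b), div_nonneg (by nlinarith) hden.le,
      (div_le_one hden).2 (by linarith), ?_⟩
    linear_combination div_mul_cancel₀ (b - r * b) hden.ne'
  have hu0 : 0 ≤ 1 - t := by linarith
  set p' : Measure α := ENNReal.ofReal (t / b) • p + ENNReal.ofReal ((1 - t) * r / b) • q with hp'
  set q' : Measure α := ENNReal.ofReal b⁻¹ • q with hq'
  have : IsFiniteMeasure q' := q.smul_finite ENNReal.ofReal_ne_top
  have : IsFiniteMeasure (ENNReal.ofReal (t / b) • p) := p.smul_finite ENNReal.ofReal_ne_top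
  have : IsFiniteMeasure (ENNReal.ofReal ((1 - t) * r / b) • q) :=
    q.smul_finite ENNReal.ofReal_ne_top
  have p'_real (s : Set α) : p'.real s = (t * p.real s + (1 - t) * r * q.real s) / b := by
    rw [hp', measureReal_add_apply, measureReal_ennreal_smul_apply,
      measureReal_ennreal_smul_apply, ENNReal.toReal_ofReal (by positivity),
      ENNReal.toReal_ofReal (by positivity)]
    ring
  have q'_real (s : Set α) : q'.real s = q.real s / b := by
    rw [hq', measureReal_ennreal_smul_apply, ENNReal.toReal_ofReal (by positivity)]
    ring
  refine ⟨p', q', ⟨?_⟩, ⟨?_⟩, ?_⟩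
  · rw [← ofReal_measureReal (μ := p'), p'_real, ← ha, ← hb, ht, div_self hb0.ne',
      ENNReal.ofReal_one]
  · rw [← ofReal_measureReal (μ := q'), q'_real, ← hb, div_self hb0.ne', ENNReal.ofReal_one]
  have scale {x : ℝ} (hx : 0 ≤ x) : w * (x / b) ≤ x := by
    rw [mul_div_assoc', div_le_iff₀ hb0, mul_comm]
    gcongr
  simp only [ofReal_smul_le_iff_measureReal hr.le, ofReal_smul_le_iff_measureReal hw.le, p'_real,
    q'_real]
  refine ⟨fun s hs => ?_, fun s hs => scale measureReal_nonneg, fun s hs => ?_, fun s hs => ?_⟩ <;>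
    have h0 : 0 ≤ p.real s := measureReal_nonneg <;>
    have h1 : 0 ≤ q.real s := measureReal_nonneg <;>
    have h2 := hpq s hs <;>
    have h3 := hqp s hs
  · refine (scale (by positivity)).trans ?_
    nlinarith
  · rw [mul_div_assoc']
    gcongr
    have h4 : r * r * q.real s ≤ q.real s := by nlinarith [mul_nonneg hr.le h1]
    nlinarith
  · rw [mul_div_assoc']
    gcongr
    nlinarith

/-- Two mutually `(ε, δ)`-close probability measures share a fraction `1 - δ` of their mass with a
mutually `(ε, 0)`-close pair. -/
lemma exists_pure_pair_of_approx {α : Type*} [MeasurableSpace α] {P Q : Measure α}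
    [IsProbabilityMeasure P] [IsProbabilityMeasure Q] {ε δ : ℝ} (hε : 0 < ε) (hδ0 : 0 ≤ δ)
    (hδ1 : δ < 1)
    (hPQ : ∀ S, MeasurableSet S →
      P S ≤ ENNReal.ofReal (Real.exp ε) * Q S + ENNReal.ofReal δ)
    (hQP : ∀ S, MeasurableSet S →
      Q S ≤ ENNReal.ofReal (Real.exp ε) * P S + ENNReal.ofReal δ) :
    ∃ P' Q' : Measure α, IsProbabilityMeasure P' ∧ IsProbabilityMeasure Q' ∧
      ENNReal.ofReal (1 - δ) • P' ≤ P ∧ ENNReal.ofReal (1 - δ) • Q' ≤ Q ∧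
      ENNReal.ofReal (Real.exp (-ε)) • P' ≤ Q' ∧ ENNReal.ofReal (Real.exp (-ε)) • Q' ≤ P' := by
  set c := ENNReal.ofReal (Real.exp ε) with hc
  set r := ENNReal.ofReal (Real.exp (-ε)) with hr
  have hrc : r * c = 1 := by
    rw [hr, hc, ← ENNReal.ofReal_mul (Real.exp_nonneg _), ← Real.exp_add]
    simp
  have hrc' : r ≤ c := ENNReal.ofReal_le_ofReal (Real.exp_le_exp.2 (by linarith))
  have trunc_le (μ ν : Measure α) : r • (μ ⊓ c • ν) ≤ ν ⊓ c • μ := by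
    refine le_inf ?_ ?_
    · calc r • (μ ⊓ c • ν) ≤ r • c • ν := by gcongr; exact inf_le_right
        _ = ν := by rw [smul_smul, hrc, one_smul]
    · calc r • (μ ⊓ c • ν) ≤ r • μ := by gcongr; exact inf_le_left
        _ ≤ c • μ := by gcongr
  have : IsFiniteMeasure (P ⊓ c • Q) := isFiniteMeasure_of_le P inf_le_left
  have : IsFiniteMeasure (Q ⊓ c • P) := isFiniteMeasure_of_le Q inf_le_left
  have mass {μ ν : Measure α} [IsProbabilityMeasure μ]
      (h : ∀ S, MeasurableSet S → μ S ≤ c * ν S + ENNReal.ofReal δ) :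
      1 - δ ≤ (μ ⊓ c • ν).real univ := by
    have : IsFiniteMeasure (μ ⊓ c • ν) := isFiniteMeasure_of_le μ inf_le_left
    have h1 := one_sub_le_inf_smul_univ h
    rwa [← ENNReal.ofReal_one, ← ENNReal.ofReal_sub _ hδ0, ← ofReal_measureReal,
      ENNReal.ofReal_le_ofReal_iff measureReal_nonneg] at h1
  have hr1 : Real.exp (-ε) < 1 := by simpa using hε
  rcases le_total ((Q ⊓ c • P).real univ) ((P ⊓ c • Q).real univ) with hle | hle
  · obtain ⟨P', Q', h1, h2, h3, h4, h5, h6⟩ := exists_probability_smul_le_of_le (Real.exp_pos _)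
      hr1 (sub_pos.2 hδ1) (trunc_le P Q) (trunc_le Q P) (mass hQP) hle
    exact ⟨P', Q', h1, h2, h3.trans inf_le_left, h4.trans inf_le_left, h5, h6⟩
  · obtain ⟨Q', P', h1, h2, h3, h4, h5, h6⟩ := exists_probability_smul_le_of_le (Real.exp_pos _)
      hr1 (sub_pos.2 hδ1) (trunc_le Q P) (trunc_le P Q) (mass hPQ) hle
    exact ⟨P', Q', h2, h1, h4.trans inf_le_left, h3.trans inf_le_left, h6, h5⟩

/-- The chord bound on `x` as a convex function of `e^{-x}` over `[-ε, ε]`. -/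
lemma le_chord_exp_neg {ε x : ℝ} (hε : 0 < ε) (hx : x ∈ Icc (-ε) ε) :
    x ≤ (Real.exp ε - 1) * ε / (Real.exp ε + 1) +
      2 * ε / (Real.exp ε - Real.exp (-ε)) * (1 - Real.exp (-x)) := by
  have hd : 0 < Real.exp ε - Real.exp (-ε) := sub_pos.2 (Real.exp_lt_exp.2 (by linarith))
  have hconv := convexOn_exp.2 (mem_univ (-ε)) (mem_univ ε)
    (show 0 ≤ (ε + x) / (2 * ε) from div_nonneg (by linarith [hx.1]) (by positivity))
    (show 0 ≤ (ε - x) / (2 * ε) from div_nonneg (by linarith [hx.2]) (by positivity))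
    (by field_simp; ring)
  simp only [smul_eq_mul] at hconv
  rw [show (ε + x) / (2 * ε) * -ε + (ε - x) / (2 * ε) * ε = -x by field_simp; ring] at hconv
  have hprod : Real.exp ε * Real.exp (-ε) = 1 := by rw [← Real.exp_add]; simp
  have hmean : (Real.exp ε - 1) * ε / (Real.exp ε + 1) =
      ε - 2 * ε * (1 - Real.exp (-ε)) / (Real.exp ε - Real.exp (-ε)) := by
    have := hd.ne'
    have : Real.exp ε + 1 ≠ 0 := by positivity
    field_simp
    linear_combination (-2) * hprod
  have hy : 2 * ε * (Real.exp (-x) - Real.exp (-ε)) / (Real.exp ε - Real.exp (-ε)) ≤ ε - x := by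
    rw [div_le_iff₀ hd]
    calc 2 * ε * (Real.exp (-x) - Real.exp (-ε))
        ≤ 2 * ε * ((ε + x) / (2 * ε) * Real.exp (-ε) + (ε - x) / (2 * ε) * Real.exp ε -
            Real.exp (-ε)) := by gcongr
      _ = (ε - x) * (Real.exp ε - Real.exp (-ε)) := by field_simp; ring
  rw [hmean]
  calc x ≤ ε - 2 * ε * (Real.exp (-x) - Real.exp (-ε)) / (Real.exp ε - Real.exp (-ε)) := by
        linarith
    _ = _ := by ring

lemma exists_privacy_loss {α : Type*} [MeasurableSpace α] {P Q : Measure α}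
    [IsProbabilityMeasure P] [IsProbabilityMeasure Q] {ε : ℝ} (hε : 0 ≤ ε)
    (hPQ : ENNReal.ofReal (Real.exp (-ε)) • P ≤ Q)
    (hQP : ENNReal.ofReal (Real.exp (-ε)) • Q ≤ P) :
    ∃ X : α → ℝ, Measurable X ∧ (∀ x, X x ∈ Icc (-ε) ε) ∧
      Q = P.withDensity fun x => ENNReal.ofReal (Real.exp (-X x)) := by
  have hac : Q ≪ P := by
    refine Measure.AbsolutelyContinuous.mk fun s _ hs => ?_
    have := (hQP s).trans_eq hs
    simpa [not_le.2 (Real.exp_pos (-ε))] using this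
  have hQP' (s : Set α) : Q s ≤ ENNReal.ofReal (Real.exp ε) * P s := by
    calc Q s = ENNReal.ofReal (Real.exp ε) * (ENNReal.ofReal (Real.exp (-ε)) * Q s) := by
          rw [← mul_assoc, ← ENNReal.ofReal_mul (Real.exp_nonneg _), ← Real.exp_add]
          simp
      _ ≤ _ := by gcongr; exact hQP s
  have hf := Measure.measurable_rnDeriv Q P
  have hupper : Q.rnDeriv P ≤ᵐ[P] fun _ => ENNReal.ofReal (Real.exp ε) := by
    refine ae_le_of_forall_setLIntegral_le_of_sigmaFinite hf fun s _ _ => ?_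
    rw [setLIntegral_const]
    exact (Measure.setLIntegral_rnDeriv_le s).trans (hQP' s)
  have hlower : (fun _ => ENNReal.ofReal (Real.exp (-ε))) ≤ᵐ[P] Q.rnDeriv P := by
    refine ae_le_of_forall_setLIntegral_le_of_sigmaFinite measurable_const fun s _ _ => ?_
    rw [setLIntegral_const, Measure.setLIntegral_rnDeriv hac]
    exact hPQ s
  refine ⟨fun x => max (-ε) (min ε (-Real.log (Q.rnDeriv P x).toReal)), by fun_prop,
    fun x => ⟨le_max_left _ _, max_le (by linarith) (min_le_left _ _)⟩, ?_⟩
  conv_lhs => rw [← Measure.withDensity_rnDeriv_eq Q P hac]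
  refine withDensity_congr_ae ?_
  filter_upwards [hupper, hlower] with x hx1 hx2
  have htop : Q.rnDeriv P x ≠ ∞ := ne_top_of_le_ne_top ENNReal.ofReal_ne_top hx1
  rw [← ENNReal.ofReal_toReal htop, ENNReal.ofReal_le_ofReal_iff (Real.exp_nonneg _)] at hx1
  rw [ENNReal.ofReal_le_iff_le_toReal htop] at hx2
  have hpos : 0 < (Q.rnDeriv P x).toReal := (Real.exp_pos _).trans_le hx2
  have h1 := (Real.log_le_iff_le_exp hpos).2 hx1
  have h2 := (Real.le_log_iff_exp_le hpos).2 hx2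
  rw [min_eq_right (by linarith), max_eq_right (by linarith), neg_neg, Real.exp_log hpos,
    ENNReal.ofReal_toReal htop]

/-- Moment generating function bound for a bounded privacy loss, via Hoeffding's lemma. -/
lemma lintegral_exp_mul_privacy_loss_le {α : Type*} [MeasurableSpace α] {P : Measure α}
    [IsProbabilityMeasure P] {ε : ℝ} (hε : 0 < ε) {X : α → ℝ} (hX : Measurable X)
    (hmem : ∀ x, X x ∈ Icc (-ε) ε)
    (hone : ∫⁻ x, ENNReal.ofReal (Real.exp (-X x)) ∂P = 1) {l : ℝ} (hl : 0 ≤ l) :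
    ∫⁻ x, ENNReal.ofReal (Real.exp (l * X x)) ∂P ≤ ENNReal.ofReal
      (Real.exp (l * ((Real.exp ε - 1) * ε / (Real.exp ε + 1)) + l ^ 2 * ε ^ 2 / 2)) := by
  have hint (t : ℝ) : Integrable (fun x => Real.exp (t * X x)) P :=
    integrable_exp_mul_of_mem_Icc hX.aemeasurable (.of_forall hmem)
  have hintX : Integrable X P := .of_mem_Icc (-ε) ε hX.aemeasurable (.of_forall hmem)
  have hint' : Integrable (fun x => Real.exp (-X x)) P := by simpa using hint (-1)
  have hone' : ∫ x, Real.exp (-X x) ∂P = 1 := by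
    rw [integral_eq_lintegral_of_nonneg_ae (.of_forall fun _ => Real.exp_nonneg _)
      hint'.aestronglyMeasurable, hone, ENNReal.toReal_one]
  have hmean : ∫ x, X x ∂P ≤ (Real.exp ε - 1) * ε / (Real.exp ε + 1) := by
    have hsub : Integrable (fun x => 1 - Real.exp (-X x)) P := (integrable_const 1).sub hint'
    refine (integral_mono hintX ?_ fun x => le_chord_exp_neg hε (hmem x)).trans_eq ?_
    · exact (integrable_const _).add (hsub.const_mul _)
    · rw [integral_add (integrable_const _) (hsub.const_mul _),
        integral_const_mul, integral_sub (integrable_const _) hint', hone']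
      simp
  rw [← ofReal_integral_eq_lintegral_ofReal (hint l) (.of_forall fun _ => Real.exp_nonneg _)]
  refine ENNReal.ofReal_le_ofReal ?_
  have hsub := (hasSubgaussianMGF_of_mem_Icc (μ := P) hX.aemeasurable (.of_forall hmem)).mgf_le l
  have hnorm : (((‖ε - -ε‖₊ / 2) ^ 2 : NNReal) : ℝ) = ε ^ 2 := by
    push_cast
    rw [Real.norm_of_nonneg (by linarith)]
    ring
  rw [hnorm, mgf] at hsub
  calc ∫ x, Real.exp (l * X x) ∂P
      = Real.exp (l * ∫ x, X x ∂P) * ∫ x, Real.exp (l * (X x - ∫ y, X y ∂P)) ∂P := by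
        rw [← integral_const_mul]
        refine integral_congr_ae (.of_forall fun x => ?_)
        simp only
        rw [← Real.exp_add]
        ring_nf
    _ ≤ Real.exp (l * ∫ x, X x ∂P) * Real.exp (ε ^ 2 * l ^ 2 / 2) := by gcongr
    _ ≤ _ := by
        rw [← Real.exp_add, Real.exp_le_exp]
        nlinarith [mul_le_mul_of_nonneg_left hmean hl]

lemma one_le_exp_neg_add_exp_mul_div {l u : ℝ} (hl : 0 ≤ l) :
    1 ≤ Real.exp (-u) + Real.exp (l * u) / (1 + l) := by
  have h1 : 0 < 1 + l := by linarith
  rcases le_total u 0 with hu | hu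
  · have : 1 ≤ Real.exp (-u) := Real.one_le_exp (by linarith)
    have : 0 ≤ Real.exp (l * u) / (1 + l) := by positivity
    linarith
  rw [← sub_le_iff_le_add', le_div_iff₀ h1]
  rcases le_total u 1 with hu1 | hu1
  · nlinarith [Real.add_one_le_exp (-u), Real.add_one_le_exp (l * u)]
  · nlinarith [Real.exp_nonneg (-u), Real.add_one_le_exp (l * u)]

/-- Advanced composition of pure differential privacy, with a free Chernoff parameter `l`. -/
lemma pi_le_of_pure {ι : Type*} [Fintype ι] {R : ι → Type*} [∀ j, MeasurableSpace (R j)]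
    {P Q : ∀ j, Measure (R j)} [∀ j, IsProbabilityMeasure (P j)]
    [∀ j, IsProbabilityMeasure (Q j)] {ε : ℝ} (hε : 0 < ε)
    (hPQ : ∀ j, ENNReal.ofReal (Real.exp (-ε)) • P j ≤ Q j)
    (hQP : ∀ j, ENNReal.ofReal (Real.exp (-ε)) • Q j ≤ P j) {l E : ℝ} (hl : 0 ≤ l)
    {S : Set (∀ j, R j)} (hS : MeasurableSet S) :
    Measure.pi P S ≤ ENNReal.ofReal (Real.exp E) * Measure.pi Q S + ENNReal.ofReal
      (Real.exp (Fintype.card ι * (l * ((Real.exp ε - 1) * ε / (Real.exp ε + 1)) +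
        l ^ 2 * ε ^ 2 / 2) - l * E) / (1 + l)) := by
  choose X hX hmem hQ using fun j => exists_privacy_loss hε.le (hPQ j) (hQP j)
  have hone (j : ι) : ∫⁻ x, ENNReal.ofReal (Real.exp (-X j x)) ∂P j = 1 := by
    rw [← setLIntegral_univ, ← withDensity_apply _ .univ, ← hQ, measure_univ]
  have hdens : Measure.pi Q = (Measure.pi P).withDensity
      fun x => ∏ j, ENNReal.ofReal (Real.exp (-X j (x j))) := by
    have (j : ι) : SigmaFinite
        ((P j).withDensity fun x => ENNReal.ofReal (Real.exp (-X j x))) := by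
      rw [← hQ]; infer_instance
    rw [← pi_withDensity_eq P (f := fun j x => ENNReal.ofReal (Real.exp (-X j x)))
      fun j => (hX j).neg.exp.ennreal_ofReal]
    congr 1
    exact funext hQ
  have hXm (j : ι) : Measurable fun x : ∀ j, R j => X j (x j) :=
    (hX j).comp (measurable_pi_apply j)
  have hm (t : ℝ) : Measurable fun x : ∀ j, R j =>
      ∏ j, ENNReal.ofReal (Real.exp (t * X j (x j))) :=
    Finset.measurable_fun_prod _ fun j _ => (((hXm j).const_mul t).exp).ennreal_ofReal
  have hm' : Measurable fun x : ∀ j, R j => ∏ j, ENNReal.ofReal (Real.exp (-X j (x j))) :=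
    by simpa using hm (-1)
  set c := ENNReal.ofReal (Real.exp (-(l * E)) / (1 + l)) with hc
  have pointwise (x : ∀ j, R j) : 1 ≤
      ENNReal.ofReal (Real.exp E) * ∏ j, ENNReal.ofReal (Real.exp (-X j (x j))) +
        c * ∏ j, ENNReal.ofReal (Real.exp (l * X j (x j))) := by
    rw [← ENNReal.ofReal_prod_of_nonneg fun _ _ => Real.exp_nonneg _,
      ← ENNReal.ofReal_prod_of_nonneg fun _ _ => Real.exp_nonneg _,
      ← ENNReal.ofReal_mul (by positivity), ← ENNReal.ofReal_mul (by positivity),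
      ← ENNReal.ofReal_add (by positivity) (by positivity), ← ENNReal.ofReal_one]
    refine ENNReal.ofReal_le_ofReal ?_
    refine (one_le_exp_neg_add_exp_mul_div (u := ∑ j, X j (x j) - E) hl).trans_eq ?_
    rw [← Real.exp_sum, ← Real.exp_sum, ← Real.exp_add, div_mul_eq_mul_div, ← Real.exp_add,
      Finset.sum_neg_distrib, ← Finset.mul_sum]
    ring_nf
  calc Measure.pi P S = ∫⁻ _ in S, 1 ∂Measure.pi P := by simp
    _ ≤ ∫⁻ x in S, (ENNReal.ofReal (Real.exp E) *
          ∏ j, ENNReal.ofReal (Real.exp (-X j (x j))) +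
        c * ∏ j, ENNReal.ofReal (Real.exp (l * X j (x j)))) ∂Measure.pi P :=
        lintegral_mono pointwise
    _ = ENNReal.ofReal (Real.exp E) * Measure.pi Q S + c *
          ∫⁻ x in S, ∏ j, ENNReal.ofReal (Real.exp (l * X j (x j))) ∂Measure.pi P := by
        rw [lintegral_add_left (hm'.const_mul _), lintegral_const_mul _ hm',
          lintegral_const_mul _ (hm l), hdens, withDensity_apply _ hS]
    _ ≤ _ := by
        gcongr
        calc c * ∫⁻ x in S, ∏ j, ENNReal.ofReal (Real.exp (l * X j (x j))) ∂Measure.pi P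
            ≤ c * ∫⁻ x, ∏ j, ENNReal.ofReal (Real.exp (l * X j (x j))) ∂Measure.pi P := by
              exact mul_le_mul' le_rfl (setLIntegral_le_lintegral _ _)
          _ ≤ c * ∏ _j : ι, ENNReal.ofReal (Real.exp
                (l * ((Real.exp ε - 1) * ε / (Real.exp ε + 1)) + l ^ 2 * ε ^ 2 / 2)) := by
              rw [lintegral_pi_prod_eq_prod_lintegral P fun j =>
                (((hX j).const_mul l).exp).ennreal_ofReal]
              gcongr with j
              exact lintegral_exp_mul_privacy_loss_le hε (hX j) (hmem j) (hone j) hl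
          _ = _ := by
              rw [Finset.prod_const, Finset.card_univ, ← ENNReal.ofReal_pow (Real.exp_nonneg _),
                hc, ← ENNReal.ofReal_mul (by positivity), ← Real.exp_nat_mul,
                div_mul_eq_mul_div, ← Real.exp_add]
              ring_nf

lemma pi_le_of_pure_sqrt {ι : Type*} [Fintype ι] [Nonempty ι] {R : ι → Type*}
    [∀ j, MeasurableSpace (R j)] {P Q : ∀ j, Measure (R j)}
    [∀ j, IsProbabilityMeasure (P j)] [∀ j, IsProbabilityMeasure (Q j)] {ε : ℝ} (hε : 0 < ε)
    (hPQ : ∀ j, ENNReal.ofReal (Real.exp (-ε)) • P j ≤ Q j)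
    (hQP : ∀ j, ENNReal.ofReal (Real.exp (-ε)) • Q j ≤ P j) {L η : ℝ} (hL : 0 ≤ L)
    (hη : Real.exp (-L) ≤ (1 + √(2 * L) / √(Fintype.card ι * ε ^ 2)) * η)
    {S : Set (∀ j, R j)} (hS : MeasurableSet S) :
    Measure.pi P S ≤ ENNReal.ofReal (Real.exp
      ((Real.exp ε - 1) * Fintype.card ι * ε / (Real.exp ε + 1) +
        ε * √(2 * Fintype.card ι * L))) * Measure.pi Q S + ENNReal.ofReal η := by
  have hk : (0 : ℝ) < Fintype.card ι := by exact_mod_cast Fintype.card_pos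
  set k := (Fintype.card ι : ℝ)
  have hsqrt : √(k * ε ^ 2) = √k * ε := by rw [Real.sqrt_mul hk.le, Real.sqrt_sq hε.le]
  have hsqrt' : √(2 * k * L) = √k * √(2 * L) := by rw [← Real.sqrt_mul hk.le]; ring_nf
  have hsk : 0 < √k := Real.sqrt_pos.2 hk
  have hsk2 : √k ^ 2 = k := Real.sq_sqrt hk.le
  have hsL2 : √(2 * L) ^ 2 = 2 * L := Real.sq_sqrt (by linarith)
  set l := √(2 * L) / √(k * ε ^ 2) with hl
  have hl0 : 0 ≤ l := by positivity
  refine (pi_le_of_pure hε hPQ hQP hl0 hS).trans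
    (add_le_add le_rfl (ENNReal.ofReal_le_ofReal ?_))
  rw [div_le_iff₀ (by positivity), mul_comm η]
  refine le_trans (Real.exp_le_exp.2 (le_of_eq ?_)) hη
  have hlε : √k * l * ε = √(2 * L) := by
    rw [hl, hsqrt]
    field_simp
  rw [hsqrt']
  have e1 : k * (l ^ 2 * ε ^ 2 / 2) = L := by
    rw [← hsk2]
    linear_combination (√k * l * ε + √(2 * L)) / 2 * hlε + hsL2 / 2
  have e2 : l * (ε * (√k * √(2 * L))) = 2 * L := by
    linear_combination √(2 * L) * hlε + hsL2
  linear_combination e1 - e2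

/-- Composition of approximate differential privacy from composition of the pure parts. -/
lemma pi_le_of_smul_le {ι : Type*} [Fintype ι] {R : ι → Type*} [∀ j, MeasurableSpace (R j)]
    {P Q P' Q' : ∀ j, Measure (R j)} [∀ j, IsProbabilityMeasure (P j)]
    [∀ j, IsProbabilityMeasure (Q j)] [∀ j, IsProbabilityMeasure (P' j)]
    [∀ j, IsProbabilityMeasure (Q' j)] {w E η : ℝ} (hw : 0 ≤ w) (hη : 0 ≤ η)
    (hP : ∀ j, ENNReal.ofReal w • P' j ≤ P j) (hQ : ∀ j, ENNReal.ofReal w • Q' j ≤ Q j)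
    {S : Set (∀ j, R j)} (hS : MeasurableSet S)
    (h : Measure.pi P' S ≤ ENNReal.ofReal (Real.exp E) * Measure.pi Q' S + ENNReal.ofReal η) :
    Measure.pi P S ≤ ENNReal.ofReal (Real.exp E) * Measure.pi Q S +
      ENNReal.ofReal (1 - w ^ Fintype.card ι * (1 - η)) := by
  have hP := smul_pi_le_pi hP
  have hQ := smul_pi_le_pi hQ
  rw [← ENNReal.ofReal_pow hw] at hP hQ
  set W := w ^ Fintype.card ι
  have hW : 0 ≤ W := pow_nonneg hw _
  rw [ofReal_smul_le_iff_measureReal hW] at hP hQ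
  have hPc := hP _ hS.compl
  have hQs := hQ _ hS
  have h1 : (Measure.pi P').real S ≤ Real.exp E * (Measure.pi Q').real S + η := by
    rw [← ofReal_measureReal (μ := Measure.pi P'), ← ofReal_measureReal (μ := Measure.pi Q'),
      ← ENNReal.ofReal_mul (Real.exp_nonneg _), ← ENNReal.ofReal_add (by positivity) hη] at h
    exact (ENNReal.ofReal_le_ofReal_iff (by positivity)).1 h
  rw [probReal_compl_eq_one_sub hS, probReal_compl_eq_one_sub hS] at hPc
  rw [← ofReal_measureReal (μ := Measure.pi P), ← ofReal_measureReal (μ := Measure.pi Q),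
    ← ENNReal.ofReal_mul (Real.exp_nonneg _)]
  refine (ENNReal.ofReal_le_ofReal ?_).trans ENNReal.ofReal_add_le
  nlinarith [mul_le_mul_of_nonneg_left h1 hW,
    mul_le_mul_of_nonneg_left hQs (Real.exp_nonneg E)]

end Composition

/-- `k`-fold composition for homogeneous mechanisms: if each of `k` mechanisms `K j` is
`(ε, δ)`-differentially private for both ordered pairs `(D₁, D₂)` and `(D₂, D₁)`, then
for any `δ̃ ∈ (0, 1]` the product mechanism `D ↦ ⊗ⱼ K j D` is
`(ε̃, 1 − (1 − δ)^k·(1 − δ̃))`-differentially private for `(D₁, D₂)`, where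
`ε̃` is the minimum of `kε`, `((e^ε−1)kε)/(e^ε+1) + ε·√(2k·ln(e + √(kε²)/δ̃))` and
`((e^ε−1)kε)/(e^ε+1) + ε·√(2k·ln(1/δ̃))`. -/
theorem diff_privacy_kfold_adaptive_composition
    {DB : Type*} (k : ℕ) (hk : 1 ≤ k) {R : Fin k → Type*}
    [∀ j, MeasurableSpace (R j)]
    (K : ∀ j : Fin k, DB → Measure (R j))
    (hprob : ∀ j D, IsProbabilityMeasure (K j D))
    (ε δ δ' : ℝ) (hε : 0 < ε) (hδ : δ ∈ Set.Icc (0 : ℝ) 1) (hδ' : δ' ∈ Set.Ioc (0 : ℝ) 1)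
    (D₁ D₂ : DB)
    (hDP₁₂ : ∀ j, ∀ S : Set (R j), MeasurableSet S →
      K j D₁ S ≤ ENNReal.ofReal (Real.exp ε) * K j D₂ S + ENNReal.ofReal δ)
    (hDP₂₁ : ∀ j, ∀ S : Set (R j), MeasurableSet S →
      K j D₂ S ≤ ENNReal.ofReal (Real.exp ε) * K j D₁ S + ENNReal.ofReal δ) :
    ∀ S : Set (∀ j, R j), MeasurableSet S →
      Measure.pi (fun j => K j D₁) S ≤
        ENNReal.ofReal (Real.exp (min (k * ε) (min
            ((Real.exp ε - 1) * k * ε / (Real.exp ε + 1) +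
              ε * Real.sqrt (2 * k * Real.log (Real.exp 1 + Real.sqrt (k * ε ^ 2) / δ')))
            ((Real.exp ε - 1) * k * ε / (Real.exp ε + 1) +
              ε * Real.sqrt (2 * k * Real.log (1 / δ')))))) *
          Measure.pi (fun j => K j D₂) S +
        ENNReal.ofReal (1 - (1 - δ) ^ k * (1 - δ')) := by
  intro S hS
  have hkpos : (0 : ℝ) < k := by exact_mod_cast hk
  have : Nonempty (Fin k) := ⟨⟨0, hk⟩⟩
  have (j : Fin k) := hprob j D₁
  have (j : Fin k) := hprob j D₂
  obtain ⟨hη0, hη1⟩ := hδ'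
  rcases hδ.2.eq_or_lt with rfl | hδ1
  · refine le_add_left (prob_le_one.trans_eq ?_)
    simp [(Nat.one_le_iff_ne_zero.1 hk)]
  choose P Q hP hQ hPw hQw hPQ hQP using fun j =>
    exists_pure_pair_of_approx hε hδ.1 hδ1 (hDP₁₂ j) (hDP₂₁ j)
  have lift {E : ℝ} (h : Measure.pi P S ≤
      ENNReal.ofReal (Real.exp E) * Measure.pi Q S + ENNReal.ofReal δ') :
      Measure.pi (fun j => K j D₁) S ≤ ENNReal.ofReal (Real.exp E) *
        Measure.pi (fun j => K j D₂) S + ENNReal.ofReal (1 - (1 - δ) ^ k * (1 - δ')) := by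
    simpa using pi_le_of_smul_le (sub_nonneg.2 hδ.2) hη0.le hPw hQw hS h
  refine lift ?_
  have advanced {L : ℝ} (hL : 0 ≤ L)
      (hη : Real.exp (-L) ≤ (1 + √(2 * L) / √(k * ε ^ 2)) * δ') :
      Measure.pi P S ≤ ENNReal.ofReal (Real.exp ((Real.exp ε - 1) * k * ε / (Real.exp ε + 1) +
        ε * √(2 * k * L))) * Measure.pi Q S + ENNReal.ofReal δ' := by
    simpa using pi_le_of_pure_sqrt (L := L) hε hPQ hQP hL (by simpa using hη) hS
  refine min_rec' (fun E => Measure.pi P S ≤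
    ENNReal.ofReal (Real.exp E) * Measure.pi Q S + ENNReal.ofReal δ') ?_ <|
    min_rec' (fun E => Measure.pi P S ≤
    ENNReal.ofReal (Real.exp E) * Measure.pi Q S + ENNReal.ofReal δ') ?_ ?_
  · refine le_add_right ?_
    have h := smul_pi_le_pi hPQ S
    rw [Fintype.card_fin, ← ENNReal.ofReal_pow (Real.exp_nonneg _), ← Real.exp_nat_mul] at h
    calc Measure.pi P S = ENNReal.ofReal (Real.exp (k * ε)) *
          (ENNReal.ofReal (Real.exp (k * -ε)) * Measure.pi P S) := by
          rw [← mul_assoc, ← ENNReal.ofReal_mul (Real.exp_nonneg _), ← Real.exp_add]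
          simp
      _ ≤ _ := by gcongr; exact h
  · have hσ : 0 < √(k * ε ^ 2) := Real.sqrt_pos.2 (by positivity)
    set σ := √(k * ε ^ 2)
    have hpos : 0 < Real.exp 1 + σ / δ' := by positivity
    have hL1 : 1 ≤ Real.log (Real.exp 1 + σ / δ') := by
      rw [Real.le_log_iff_exp_le hpos]
      linarith [div_pos hσ hη0]
    refine advanced (by linarith) ?_
    set s := √(2 * Real.log (Real.exp 1 + σ / δ'))
    have hs : 1 ≤ s := Real.one_le_sqrt.2 (by linarith)
    rw [Real.exp_neg, Real.exp_log hpos]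
    refine inv_le_of_inv_le₀ (by positivity) ?_
    calc ((1 + s / σ) * δ')⁻¹ ≤ ((s / σ) * δ')⁻¹ := by gcongr; linarith
      _ = σ / δ' / s := by field_simp
      _ ≤ σ / δ' := div_le_self (by positivity) hs
      _ ≤ _ := by linarith [Real.exp_pos 1]
  · refine advanced (Real.log_nonneg ((one_le_div hη0).2 hη1)) ?_
    rw [Real.exp_neg, Real.exp_log (by positivity), one_div, inv_inv]
    exact le_mul_of_one_le_left hη0.le (le_add_of_nonneg_right (by positivity))
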